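/- arXiv:1509.05365 — 9 statements merged into one kernel-verified Lean document; each statement's English description precedes it below -/
import Mathlib

section
/- Suppose x̃, y ∈ K are such that (x̃, y) lies on E over K, and suppose y' ∈ L is such that (x̃, y') lies on E over L (with x̃ viewed in L). Then y' lies in K. (In the paper's notation this shows A_n ∩ B_n = E₀: an x-coordinate of a K-rational point of E cannot also be the x-coordinate of a point whose y-coordinate lies in L but not in K.) -/
/-- `(x, y)` lies on the Weierstrass curve
`y² + a₁xy + a₃y = x³ + a₂x² + a₄x + a₆`. -/
def OnE {F : Type*} [CommRing F] (a₁ a₂ a₃ a₄ a₆ x y : F) : Prop :=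
  y ^ 2 + a₁ * x * y + a₃ * y = x ^ 3 + a₂ * x ^ 2 + a₄ * x + a₆

/-- If `xt` is the `x`-coordinate of a `K`-rational point of `E`, then every point of `E` over the
quadratic extension `L` with `x`-coordinate `xt` has its `y`-coordinate in `K`. -/
theorem stmt1 (K L : Type*) [Field K] [Fintype K] [Field L] [Algebra K L]
    (hL : Module.finrank K L = 2)
    (a₁ a₂ a₃ a₄ a₆ : K) (xt y : K)
    (hK : OnE a₁ a₂ a₃ a₄ a₆ xt y)
    (y' : L)
    (hL' : OnE (algebraMap K L a₁) (algebraMap K L a₂) (algebraMap K L a₃)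
      (algebraMap K L a₄) (algebraMap K L a₆) (algebraMap K L xt) y') :
    y' ∈ Set.range (algebraMap K L) := by
  have hK' := congrArg (algebraMap K L) hK
  simp only [map_add, map_mul, map_pow] at hK'
  unfold OnE at hL'
  have hfactor : (y' - algebraMap K L y) *
      (y' + algebraMap K L y + algebraMap K L a₁ * algebraMap K L xt + algebraMap K L a₃) = 0 := by
    linear_combination hL' - hK'
  rcases mul_eq_zero.mp hfactor with h | h
  · exact ⟨y, (sub_eq_zero.mp h).symm⟩
  · refine ⟨-y - a₁ * xt - a₃, ?_⟩
    simp only [map_sub, map_neg, map_mul]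
    linear_combination -h
end

section
/- Let Q = |K| and suppose (x, y) lies on E over L, where x lies in K. Then: (i) y^Q = y if and only if y lies in K (equivalently, the Q-power Frobenius fixes the point (x,y) if and only if (x,y) is a K-rational point of E); and (ii) y^Q = −y − a₁x − a₃ if and only if either y does not lie in K, or 2y + a₁x + a₃ = 0 (equivalently, the Q-power Frobenius sends (x,y) to its negative on E if and only if either y ∉ K or (x,y) is its own negative). -/
open Polynomial in
/-- The elements of an extension of a finite field `K` fixed by the `|K|`-power map are those
of `K`. -/
theorem pow_card_eq_self_iff_mem_range {K L : Type*} [Field K] [Fintype K] [Field L]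
    [Algebra K L] (y : L) :
    y ^ Fintype.card K = y ↔ y ∈ Set.range (algebraMap K L) := by
  constructor
  · intro h
    have hsplits : (X ^ Fintype.card K - X : K[X]).Splits := by
      rw [splits_iff_card_roots, FiniteField.roots_X_pow_card_sub_X,
        FiniteField.X_pow_card_sub_X_natDegree_eq K Fintype.one_lt_card, ← Finset.card_def,
        Finset.card_univ]
    have hroot : y ∈ ((X ^ Fintype.card K - X : K[X]).map (algebraMap K L)).roots := by
      rw [mem_roots_map (FiniteField.X_pow_card_sub_X_ne_zero K Fintype.one_lt_card)]
      simp [h]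
    rw [hsplits.roots_map] at hroot
    obtain ⟨a, -, ha⟩ := Multiset.mem_map.mp hroot
    exact ⟨a, ha⟩
  · rintro ⟨a, rfl⟩
    rw [← map_pow, FiniteField.pow_card]

/-- Let `Q = |K|` and let `(x, y)` be a point of `E` over the quadratic extension `L` whose
`x`-coordinate lies in `K`. Then (i) `y^Q = y` iff `y` lies in `K`, and (ii)
`y^Q = -y - a₁x - a₃` iff either `y` does not lie in `K` or `2y + a₁x + a₃ = 0`. -/
theorem stmt2 (K L : Type*) [Field K] [Fintype K] [Field L] [Algebra K L]
    (hL : Module.finrank K L = 2)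
    (a₁ a₂ a₃ a₄ a₆ : K) (x y : L)
    (hx : x ∈ Set.range (algebraMap K L))
    (hxy : OnE (algebraMap K L a₁) (algebraMap K L a₂) (algebraMap K L a₃)
      (algebraMap K L a₄) (algebraMap K L a₆) x y) :
    (y ^ Fintype.card K = y ↔ y ∈ Set.range (algebraMap K L)) ∧
    (y ^ Fintype.card K = -y - algebraMap K L a₁ * x - algebraMap K L a₃ ↔
      (y ∉ Set.range (algebraMap K L) ∨ 2 * y + algebraMap K L a₁ * x + algebraMap K L a₃ = 0)) := by
  have hfix := pow_card_eq_self_iff_mem_range (K := K) y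
  refine ⟨hfix, ?_⟩
  obtain ⟨b, rfl⟩ := hx
  have hFrob := congrArg (FiniteField.frobeniusAlgHom K L) hxy
  simp only [map_add, map_mul, map_pow, AlgHom.commutes,
    FiniteField.coe_frobeniusAlgHom] at hFrob
  unfold OnE at hxy
  rw [← hfix]
  have hprod : (y ^ Fintype.card K - y) *
      (y ^ Fintype.card K + y + algebraMap K L a₁ * algebraMap K L b + algebraMap K L a₃) = 0 := by
    linear_combination hFrob - hxy
  constructor
  · intro h
    by_cases hy : y ^ Fintype.card K = y
    · right
      linear_combination h - hy
    · exact Or.inl hy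
  · intro h
    rcases mul_eq_zero.mp hprod with hy | hneg
    · have htwo := h.resolve_left (not_not_intro (sub_eq_zero.mp hy))
      linear_combination hy + htwo
    · linear_combination hneg
end

section
/- For every integer h with 0 ≤ h ≤ e, the set {x ∈ R/Bᵉ : pʰ·x = 0} of elements killed by pʰ equals the image of the ideal B^{e−h} in the quotient ring R/Bᵉ, and this set has exactly Nʰ elements. -/
set_option synthInstance.maxHeartbeats 1000000
set_option maxHeartbeats 1000000

open NumberField

/-- If `a` lies in the prime `B` exactly once, then multiplication by `a ^ h` shifts the `B`-adic
filtration by exactly `h`. -/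
theorem Ideal.pow_mul_mem_pow_iff_of_mem_of_notMem_sq {R : Type*} [CommRing R]
    [IsDedekindDomain R] {B : Ideal R} (hB : Prime B) {a : R} (ha : a ∈ B) (ha2 : a ∉ B ^ 2)
    {e h : ℕ} (hhe : h ≤ e) (x : R) : a ^ h * x ∈ B ^ e ↔ x ∈ B ^ (e - h) := by
  constructor
  · intro hx
    obtain ⟨J, hJ⟩ : B ∣ Ideal.span {a} := (Ideal.dvd_span_singleton).2 ha
    have hBJ : ¬ B ∣ J := by
      intro hd
      apply ha2
      rw [← Ideal.dvd_span_singleton, hJ, sq]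
      exact mul_dvd_mul_left B hd
    rw [← Ideal.dvd_span_singleton] at hx ⊢
    rw [← Ideal.span_singleton_mul_span_singleton, ← Ideal.span_singleton_pow, hJ, mul_pow,
      mul_assoc, ← Nat.add_sub_cancel' hhe, pow_add,
      mul_dvd_mul_iff_left (pow_ne_zero h hB.ne_zero)] at hx
    exact hB.pow_dvd_of_dvd_mul_left _ (fun hd => hBJ (hB.dvd_of_dvd_pow hd)) hx
  · intro hx
    rw [← Nat.add_sub_cancel' hhe, pow_add]
    exact Ideal.mul_mem_mul (Ideal.pow_mem_pow ha h) (by simpa using hx)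

/-- The image of `B ^ (e - h)` in `S ⧸ B ^ e` has `N(B) ^ h` elements. -/
theorem Ideal.natCard_map_mk_pow {S : Type*} [CommRing S] [IsDedekindDomain S]
    [Module.Free ℤ S] [Module.Finite ℤ S] {B : Ideal S} (hB0 : B ≠ ⊥) {e h : ℕ} (hhe : h ≤ e) :
    Nat.card (Ideal.map (Ideal.Quotient.mk (B ^ e)) (B ^ (e - h))) = Ideal.absNorm B ^ h := by
  have hcard := Submodule.card_eq_card_quotient_mul_card
    (Ideal.map (Ideal.Quotient.mk (B ^ e)) (B ^ (e - h)))
  have hquot := Nat.card_congr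
    (DoubleQuot.quotQuotEquivQuotOfLE (Ideal.pow_le_pow_right (I := B) (Nat.sub_le e h))).toEquiv
  have hnorm (n : ℕ) : Nat.card (S ⧸ B ^ n) = Ideal.absNorm B ^ n := by
    rw [← map_pow, Ideal.absNorm_apply, Submodule.cardQuot_apply]
  rw [hquot, hnorm, hnorm] at hcard
  have hpos : 0 < Ideal.absNorm B ^ (e - h) :=
    pow_pos (Nat.pos_of_ne_zero (by
      have := Ideal.finiteQuotientOfFreeOfNeBot B hB0
      rw [Ideal.absNorm_apply, Submodule.cardQuot_apply]
      exact Nat.card_pos.ne')) _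
  apply Nat.eq_of_mul_eq_mul_left hpos
  rw [← pow_add, Nat.sub_add_cancel hhe, hcard, mul_comm]

/-- In the quotient `R/Bᵉ` of the ring of integers of a quadratic number field by the `e`-th
power of a prime `B` unramified over the rational prime `p`, for `0 ≤ h ≤ e` the set of elements
killed by `pʰ` is the image of the ideal `B^(e-h)`, and it has exactly `N(B)ʰ` elements. -/
theorem stmt6 (K : Type*) [Field K] [NumberField K]
    (hK : Module.finrank ℚ K = 2)
    (B : Ideal (RingOfIntegers K)) (hBprime : B.IsPrime) (hB0 : B ≠ ⊥)
    (p : ℕ) (hp : p.Prime)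
    (hpB : (p : RingOfIntegers K) ∈ B) (hpB2 : (p : RingOfIntegers K) ∉ B ^ 2)
    (e : ℕ) (he : 0 < e) (h : ℕ) (hhe : h ≤ e) :
    {x : RingOfIntegers K ⧸ B ^ e | (p : RingOfIntegers K ⧸ B ^ e) ^ h * x = 0} =
      ↑(Ideal.map (Ideal.Quotient.mk (B ^ e)) (B ^ (e - h))) ∧
    Nat.card {x : RingOfIntegers K ⧸ B ^ e | (p : RingOfIntegers K ⧸ B ^ e) ^ h * x = 0} =
      Ideal.absNorm B ^ h := by
  have hset : {x : RingOfIntegers K ⧸ B ^ e | (p : RingOfIntegers K ⧸ B ^ e) ^ h * x = 0} =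
      ↑(Ideal.map (Ideal.Quotient.mk (B ^ e)) (B ^ (e - h))) := by
    ext y
    obtain ⟨x, rfl⟩ := Ideal.Quotient.mk_surjective y
    rw [Set.mem_ofPred_eq, SetLike.mem_coe,
      Ideal.mem_quotient_iff_mem (Ideal.pow_le_pow_right (Nat.sub_le e h)),
      ← Ideal.pow_mul_mem_pow_iff_of_mem_of_notMem_sq (Ideal.prime_of_isPrime hB0 hBprime)
        hpB hpB2 hhe x, ← Ideal.Quotient.eq_zero_iff_mem, map_mul, map_pow, map_natCast]
  refine ⟨hset, ?_⟩
  rw [hset]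
  exact Ideal.natCard_map_mk_pow hB0 hhe
end

section
/- For every integer h with 1 ≤ h ≤ e, the number of elements of the quotient ring R/Bᵉ whose additive order equals pʰ is exactly Nʰ − N^{h−1}. -/
set_option synthInstance.maxHeartbeats 1000000
set_option maxHeartbeats 1000000

open NumberField

namespace Ideal

variable {S : Type*} [CommRing S] [IsDedekindDomain S] {P : Ideal S}

/-- Dividing by the `k`-th power of a uniformizer at `P` lowers the `P`-adic order by `k`. -/
theorem pow_mul_mem_prime_pow_add_iff [P.IsPrime] (hP : P ≠ ⊥) {x : S} (hx : x ∈ P)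
    (hx2 : x ∉ P ^ 2) (k m : ℕ) (a : S) : x ^ k * a ∈ P ^ (m + k) ↔ a ∈ P ^ m := by
  have hprime : Prime P := prime_of_isPrime hP inferInstance
  constructor
  · intro h
    obtain ⟨J, hJ⟩ := dvd_span_singleton.mpr hx
    have hPJ : ¬ P ∣ J := by
      rintro ⟨L, rfl⟩
      exact hx2 (dvd_span_singleton.mp ⟨L, by rw [hJ]; ring⟩)
    rw [← dvd_span_singleton, ← span_singleton_mul_span_singleton, ← span_singleton_pow, hJ,
      mul_pow, mul_assoc, add_comm, pow_add, mul_dvd_mul_iff_left (pow_ne_zero k hP)] at h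
    exact dvd_span_singleton.mp
      (hprime.pow_dvd_of_dvd_mul_left m (fun hd => hPJ (hprime.dvd_of_dvd_pow hd)) h)
  · intro h
    rw [add_comm, pow_add]
    exact mul_mem_mul (pow_mem_pow hx k) h

variable [Module.Free ℤ S] [Module.Finite ℤ S]

/-- The image of `P ^ (e - k)` in `S ⧸ P ^ e` has `N(P) ^ k` elements. -/
theorem card_ker_factor_pow (hP : P ≠ ⊥) {k e : ℕ} (hk : k ≤ e) :
    Nat.card (RingHom.ker (Quotient.factor (pow_le_pow_right (I := P) (Nat.sub_le e k)))) =
      absNorm P ^ k := by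
  have hle := pow_le_pow_right (I := P) (Nat.sub_le e k)
  set f := Quotient.factor hle
  have hcard (n : ℕ) : Nat.card (S ⧸ P ^ n) = absNorm P ^ n := by
    rw [← map_pow, absNorm_apply, Submodule.cardQuot_apply]
  have h := f.toAddMonoidHom.ker.card_mul_index
  rw [AddSubgroup.index_ker,
    AddMonoidHom.range_eq_top (f := f.toAddMonoidHom) |>.mpr (Quotient.factor_surjective hle),
    AddSubgroup.card_top, hcard, hcard] at h
  have hN : 0 < absNorm P := Nat.pos_of_ne_zero (absNorm_eq_zero_iff.not.mpr hP)
  refine Nat.eq_of_mul_eq_mul_right (pow_pos hN (e - k)) ?_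
  rw [← pow_add, Nat.add_sub_cancel' hk]
  exact h

/-- If `p` is a uniformizer at `P`, then `S ⧸ P ^ e` has `N(P) ^ k` elements killed by `p ^ k`. -/
theorem ncard_nsmul_prime_pow_eq_zero [P.IsPrime] (hP : P ≠ ⊥) {p : ℕ}
    (hp : (p : S) ∈ P) (hp2 : (p : S) ∉ P ^ 2) {k e : ℕ} (hk : k ≤ e) :
    {x : S ⧸ P ^ e | p ^ k • x = 0}.ncard = absNorm P ^ k := by
  rw [← card_ker_factor_pow hP hk, ← Nat.card_coe_set_eq]
  refine Nat.card_congr (Equiv.subtypeEquivRight fun x => ?_)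
  obtain ⟨a, rfl⟩ := Quotient.mk_surjective x
  have h := pow_mul_mem_prime_pow_add_iff hP hp hp2 k (e - k) a
  rw [Nat.sub_add_cancel hk] at h
  rw [Set.mem_ofPred_eq, RingHom.mem_ker, Quotient.factor_mk, Quotient.eq_zero_iff_mem, ← h,
    ← Quotient.eq_zero_iff_mem, nsmul_eq_mul]
  simp

end Ideal

/-- In the quotient `R/Bᵉ` of the ring of integers of a quadratic number field by the `e`-th
power of a prime `B` unramified over the rational prime `p`, for `1 ≤ h ≤ e` the number of
elements of additive order exactly `pʰ` is `N(B)ʰ - N(B)^(h-1)`. -/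
theorem stmt7 (K : Type*) [Field K] [NumberField K]
    (hK : Module.finrank ℚ K = 2)
    (B : Ideal (RingOfIntegers K)) (hBprime : B.IsPrime) (hB0 : B ≠ ⊥)
    (p : ℕ) (hp : p.Prime)
    (hpB : (p : RingOfIntegers K) ∈ B) (hpB2 : (p : RingOfIntegers K) ∉ B ^ 2)
    (e : ℕ) (he : 0 < e) (h : ℕ) (hh1 : 1 ≤ h) (hhe : h ≤ e) :
    Nat.card {x : RingOfIntegers K ⧸ B ^ e | addOrderOf x = p ^ h} =
      Ideal.absNorm B ^ h - Ideal.absNorm B ^ (h - 1) := by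
  obtain ⟨k, rfl⟩ : ∃ k, h = k + 1 := ⟨h - 1, by omega⟩
  have hset : {x : RingOfIntegers K ⧸ B ^ e | addOrderOf x = p ^ (k + 1)} =
      {x | p ^ (k + 1) • x = 0} \ {x | p ^ k • x = 0} := by
    ext x
    simp only [Set.mem_ofPred_eq, Set.mem_sdiff]
    have := Fact.mk hp
    refine ⟨fun hx => ⟨hx ▸ addOrderOf_nsmul_eq_zero x, fun h0 => ?_⟩,
      fun hx => addOrderOf_eq_prime_pow hx.2 hx.1⟩
    have hdvd := addOrderOf_dvd_of_nsmul_eq_zero h0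
    rw [hx, Nat.pow_dvd_pow_iff_le_right hp.one_lt] at hdvd
    omega
  have hsub : {x : RingOfIntegers K ⧸ B ^ e | p ^ k • x = 0} ⊆ {x | p ^ (k + 1) • x = 0} := by
    intro x hx
    rw [Set.mem_ofPred_eq] at hx ⊢
    rw [pow_succ', mul_nsmul', hx, nsmul_zero]
  have : Finite (RingOfIntegers K ⧸ B ^ e) := 
    Ideal.finiteQuotientOfFreeOfNeBot _ (pow_ne_zero e hB0)
  rw [Nat.card_coe_set_eq, hset, Set.ncard_sdiff hsub,
    Ideal.ncard_nsmul_prime_pow_eq_zero hB0 hpB hpB2 hhe,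
    Ideal.ncard_nsmul_prime_pow_eq_zero hB0 hpB hpB2 (by omega : k ≤ e), Nat.add_sub_cancel]
end

section
/- Let h be an integer with 1 ≤ h ≤ e and let x ∈ R/Bᵉ be an element of additive order pʰ. Then for every r ∈ R, the product r·x is zero in R/Bᵉ if and only if r ∈ Bʰ; that is, the annihilator in R of such an element x is exactly the ideal Bʰ. -/
set_option synthInstance.maxHeartbeats 1000000
set_option maxHeartbeats 1000000

open NumberField

namespace Ideal

variable {R : Type*} [CommRing R] [IsDedekindDomain R]

theorem mem_pow_iff_le_emultiplicity_span_singleton (P : Ideal R) (a : R) (n : ℕ) :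
    a ∈ P ^ n ↔ (n : ℕ∞) ≤ emultiplicity P (span {a}) := by
  rw [← pow_dvd_iff_le_emultiplicity, dvd_span_singleton]

theorem emultiplicity_span_singleton_mul {P : Ideal R} (hP : Prime P) (a b : R) :
    emultiplicity P (span {a * b}) =
      emultiplicity P (span {a}) + emultiplicity P (span {b}) := by
  rw [← span_singleton_mul_span_singleton, emultiplicity_mul hP]

theorem emultiplicity_span_singleton_pow_of_notMem_sq {P : Ideal R} (hP : Prime P) {a : R}
    (ha : a ∈ P) (ha2 : a ∉ P ^ 2) (k : ℕ) :
    emultiplicity P (span {a ^ k}) = k := by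
  have h1 : emultiplicity P (span {a}) = (1 : ℕ) :=
    emultiplicity_eq_coe.2 ⟨by simpa [dvd_span_singleton] using ha,
      by simpa [dvd_span_singleton] using ha2⟩
  rw [← span_singleton_pow, emultiplicity_pow hP, h1, Nat.cast_one, mul_one]

end Ideal

/-- In the quotient `R/Bᵉ` of the ring of integers of a quadratic number field by the `e`-th
power of a prime `B` unramified over the rational prime `p`, the annihilator in `R` of an
element of additive order `pʰ` (with `1 ≤ h ≤ e`) is exactly the ideal `Bʰ`. -/
theorem stmt8 (K : Type*) [Field K] [NumberField K]
    (hK : Module.finrank ℚ K = 2)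
    (B : Ideal (RingOfIntegers K)) (hBprime : B.IsPrime) (hB0 : B ≠ ⊥)
    (p : ℕ) (hp : p.Prime)
    (hpB : (p : RingOfIntegers K) ∈ B) (hpB2 : (p : RingOfIntegers K) ∉ B ^ 2)
    (e : ℕ) (he : 0 < e) (h : ℕ) (hh1 : 1 ≤ h) (hhe : h ≤ e)
    (x : RingOfIntegers K ⧸ B ^ e) (hx : addOrderOf x = p ^ h) :
    ∀ r : RingOfIntegers K, Ideal.Quotient.mk (B ^ e) r * x = 0 ↔ r ∈ B ^ h := by
  intro r
  obtain ⟨a, rfl⟩ := Ideal.Quotient.mk_surjective x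
  have hB : Prime B := Ideal.prime_of_isPrime hB0 hBprime
  have nsmul_iff (k : ℕ) : p ^ k • Ideal.Quotient.mk (B ^ e) a = 0 ↔
      (e : ℕ∞) ≤ k + emultiplicity B (Ideal.span {a}) := by
    rw [← map_nsmul, Ideal.Quotient.eq_zero_iff_mem, nsmul_eq_mul, Nat.cast_pow,
      Ideal.mem_pow_iff_le_emultiplicity_span_singleton,
      Ideal.emultiplicity_span_singleton_mul hB,
      Ideal.emultiplicity_span_singleton_pow_of_notMem_sq hB hpB hpB2]
  have hle := (nsmul_iff h).1 (hx ▸ addOrderOf_nsmul_eq_zero _)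
  have hlt := mt (nsmul_iff (h - 1)).2 fun h0 ↦ by
    have hdvd := addOrderOf_dvd_of_nsmul_eq_zero h0
    rw [hx, Nat.pow_dvd_pow_iff_le_right hp.one_lt] at hdvd
    omega
  rw [← map_mul, Ideal.Quotient.eq_zero_iff_mem,
    Ideal.mem_pow_iff_le_emultiplicity_span_singleton,
    Ideal.mem_pow_iff_le_emultiplicity_span_singleton,
    Ideal.emultiplicity_span_singleton_mul hB]
  generalize emultiplicity B (Ideal.span {a}) = m at hle hlt
  generalize emultiplicity B (Ideal.span {r}) = n
  induction m with
  | top => simp at hlt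
  | coe m =>
    induction n with
    | top => simp
    | coe n =>
      norm_cast at hle hlt ⊢
      omega
end

section
/- Let α ∈ R with α ∉ B, let h be an integer with 1 ≤ h ≤ e, and let x ∈ R/Bᵉ be an element of additive order pʰ. Then there exists a positive integer v with αᵛ − 1 ∈ Bʰ, and the smallest positive integer v such that αᵛ·x ∈ {x, −x} in R/Bᵉ is equal to the smallest positive integer v such that αᵛ − 1 ∈ Bʰ or αᵛ + 1 ∈ Bʰ. -/
set_option synthInstance.maxHeartbeats 1000000
set_option maxHeartbeats 1000000

open NumberField

/-- An element of exact `P`-adic order `m` shifts membership in powers of `P` by `m`. -/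
theorem mul_mem_pow_add_iff {R : Type*} [CommRing R] [IsDedekindDomain R] {P : Ideal R}
    (hP : P.IsPrime) (hP0 : P ≠ ⊥) {a : R} {m : ℕ} (ha : a ∈ P ^ m) (ha' : a ∉ P ^ (m + 1))
    (b : R) (n : ℕ) : a * b ∈ P ^ (m + n) ↔ b ∈ P ^ n := by
  refine ⟨fun hab => ?_, fun hb => pow_add P m n ▸ Ideal.mul_mem_mul ha hb⟩
  induction n with
  | zero => simp
  | succ n ih =>
    have hb : b ∈ P ^ n := ih (Ideal.pow_le_pow_right (by lia) hab)
    by_contra hb'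
    have hprime : Prime P := Ideal.prime_of_isPrime hP0 hP
    have key : ∀ {c : R} {k : ℕ}, c ∈ P ^ k → c ∉ P ^ (k + 1) →
        emultiplicity P (Ideal.span {c}) = k := fun hc hc' =>
      emultiplicity_eq_coe.2 ⟨by simpa [Ideal.dvd_span_singleton] using hc,
        by simpa [Ideal.dvd_span_singleton] using hc'⟩
    have hmul := emultiplicity_mul hprime (a := Ideal.span {a}) (b := Ideal.span {b})
    rw [key ha ha', key hb hb', Ideal.span_singleton_mul_span_singleton, ← Nat.cast_add] at hmul
    exact (emultiplicity_eq_coe.1 hmul).2 (by simpa [Ideal.dvd_span_singleton, add_assoc] using hab)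

/-- If `a` has exact `P`-adic order `1`, then `a ^ k` has exact `P`-adic order `k`. -/
theorem pow_mul_mem_pow_add_iff {R : Type*} [CommRing R] [IsDedekindDomain R] {P : Ideal R}
    (hP : P.IsPrime) (hP0 : P ≠ ⊥) {a : R} (ha : a ∈ P) (ha' : a ∉ P ^ 2)
    (b : R) (k n : ℕ) : a ^ k * b ∈ P ^ (k + n) ↔ b ∈ P ^ n := by
  induction k with
  | zero => simp
  | succ k ih =>
    rw [pow_succ', mul_assoc, show k + 1 + n = 1 + (k + n) by lia,
      mul_mem_pow_add_iff hP hP0 (by simpa using ha) ha', ih]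

/-- Modulo a power of a nonzero prime with finite quotient, an element outside the prime has a
positive power congruent to `1`. -/
theorem exists_pow_sub_one_mem_pow {R : Type*} [CommRing R] [IsDedekindDomain R] {P : Ideal R}
    (hP : P.IsPrime) (hP0 : P ≠ ⊥) {a : R} (ha : a ∉ P) (n : ℕ) [Finite (R ⧸ P ^ n)] :
    ∃ v : ℕ, 0 < v ∧ a ^ v - 1 ∈ P ^ n := by
  obtain ⟨i, j, hij, heq⟩ := Finite.exists_ne_map_eq_of_infinite
    fun i : ℕ => Ideal.Quotient.mk (P ^ n) (a ^ i)
  wlog hlt : i < j generalizing i j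
  · exact this j i hij.symm heq.symm (by lia)
  refine ⟨j - i, by lia, ?_⟩
  have hmem := Ideal.Quotient.eq.1 heq.symm
  have hfactor : a ^ j - a ^ i = a ^ i * (a ^ (j - i) - 1) := by
    rw [mul_sub, ← pow_add, mul_one, Nat.add_sub_cancel' hlt.le]
  rw [hfactor, ← zero_add n] at hmem
  exact (mul_mem_pow_add_iff hP hP0 (m := 0) (by simp)
    (by simpa using fun hi => ha (hP.mem_of_pow_mem i hi)) _ n).1 hmem

/-- If `p` has exact `P`-adic order `1`, the annihilator of a class of additive order `p ^ h`
modulo `P ^ e` is `P ^ h`. -/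
theorem mk_mul_eq_zero_iff_of_addOrderOf {R : Type*} [CommRing R] [IsDedekindDomain R]
    {P : Ideal R} (hP : P.IsPrime) (hP0 : P ≠ ⊥) {p : ℕ} (hp : p.Prime)
    (hpP : (p : R) ∈ P) (hpP2 : (p : R) ∉ P ^ 2) {e h : ℕ} (hh1 : 1 ≤ h) (hhe : h ≤ e)
    {x : R ⧸ P ^ e} (hx : addOrderOf x = p ^ h) (b : R) :
    Ideal.Quotient.mk (P ^ e) b * x = 0 ↔ b ∈ P ^ h := by
  obtain ⟨y, rfl⟩ := Ideal.Quotient.mk_surjective x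
  have hsmul : ∀ k ≤ e, p ^ k • Ideal.Quotient.mk (P ^ e) y = 0 ↔ y ∈ P ^ (e - k) := by
    intro k hk
    rw [← map_nsmul, Ideal.Quotient.eq_zero_iff_mem, nsmul_eq_mul, Nat.cast_pow,
      ← pow_mul_mem_pow_add_iff hP hP0 hpP hpP2 y k (e - k), Nat.add_sub_cancel' hk]
  have hy : y ∈ P ^ (e - h) := (hsmul h hhe).1 (hx ▸ addOrderOf_nsmul_eq_zero _)
  have hy' : y ∉ P ^ (e - h + 1) := by
    intro hmem
    rw [show e - h + 1 = e - (h - 1) by lia, ← hsmul (h - 1) (by lia),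
      ← addOrderOf_dvd_iff_nsmul_eq_zero, hx, Nat.pow_dvd_pow_iff_le_right hp.one_lt] at hmem
    lia
  rw [← map_mul, Ideal.Quotient.eq_zero_iff_mem, mul_comm,
    ← mul_mem_pow_add_iff hP hP0 hy hy' b h, Nat.sub_add_cancel hhe]

/-- Let `α ∈ R`, `α ∉ B`, and let `x ∈ R/Bᵉ` have additive order `pʰ` (`1 ≤ h ≤ e`). Then some
positive power of `α` is congruent to `1` modulo `Bʰ`, and the least positive `v` with
`αᵛ·x ∈ {x, -x}` equals the least positive `v` with `αᵛ - 1 ∈ Bʰ` or `αᵛ + 1 ∈ Bʰ`. -/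
theorem stmt9 (K : Type*) [Field K] [NumberField K]
    (hK : Module.finrank ℚ K = 2)
    (B : Ideal (RingOfIntegers K)) (hBprime : B.IsPrime) (hB0 : B ≠ ⊥)
    (p : ℕ) (hp : p.Prime)
    (hpB : (p : RingOfIntegers K) ∈ B) (hpB2 : (p : RingOfIntegers K) ∉ B ^ 2)
    (e : ℕ) (he : 0 < e)
    (α : RingOfIntegers K) (hα : α ∉ B)
    (h : ℕ) (hh1 : 1 ≤ h) (hhe : h ≤ e)
    (x : RingOfIntegers K ⧸ B ^ e) (hx : addOrderOf x = p ^ h) :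
    (∃ v : ℕ, 0 < v ∧ α ^ v - 1 ∈ B ^ h) ∧
    sInf {v : ℕ | 0 < v ∧
        (Ideal.Quotient.mk (B ^ e) α) ^ v * x ∈ ({x, -x} : Set (RingOfIntegers K ⧸ B ^ e))} =
      sInf {v : ℕ | 0 < v ∧ (α ^ v - 1 ∈ B ^ h ∨ α ^ v + 1 ∈ B ^ h)} := by
  have : Finite (RingOfIntegers K ⧸ B ^ h) :=
    Ideal.finiteQuotientOfFreeOfNeBot _ (pow_ne_zero h hB0)
  refine ⟨exists_pow_sub_one_mem_pow hBprime hB0 hα h, ?_⟩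
  have hann := mk_mul_eq_zero_iff_of_addOrderOf hBprime hB0 hp hpB hpB2 hh1 hhe hx
  congr 1
  ext v
  rw [Set.mem_ofPred_eq, Set.mem_ofPred_eq, ← hann, ← hann, Set.mem_insert_iff,
    Set.mem_singleton_iff, map_sub, map_add, map_pow, map_one, sub_mul, add_mul, one_mul,
    sub_eq_zero, add_eq_zero_iff_eq_neg]
end

section
/- For every non-negative integer h, the number of elements x ∈ R/Bᵉ such that αʰ·x = 0 is exactly N^{min(e, f·h)}. -/
set_option synthInstance.maxHeartbeats 1000000
set_option maxHeartbeats 1000000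

open NumberField

/-- An endomorphism of a finite module has kernel and cokernel of the same cardinality. -/
theorem LinearMap.natCard_ker_eq_natCard_quotient_range {A M : Type*} [Ring A] [AddCommGroup M]
    [Module A M] [Finite M] (φ : M →ₗ[A] M) :
    Nat.card (LinearMap.ker φ) = Nat.card (M ⧸ LinearMap.range φ) := by
  have hker := Submodule.card_eq_card_quotient_mul_card (LinearMap.ker φ)
  have hrange := Submodule.card_eq_card_quotient_mul_card (LinearMap.range φ)
  rw [Nat.card_congr φ.quotKerEquivRange.toEquiv] at hker
  have hpos : 0 < Nat.card (LinearMap.range φ) := Nat.card_pos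
  refine Nat.eq_of_mul_eq_mul_right hpos ?_
  grind

/-- If a prime `P` of a Dedekind domain has exact exponent `f` in `a`, then
`P ^ e` and `a ^ h` generate `P ^ min e (f * h)`. -/
theorem Ideal.pow_sup_span_singleton_pow {R : Type*} [CommRing R] [IsDedekindDomain R]
    {P : Ideal R} (hP : P.IsPrime) (hP0 : P ≠ ⊥) {f : ℕ} {a : R}
    (ha : a ∈ P ^ f) (ha' : a ∉ P ^ (f + 1)) (e h : ℕ) :
    P ^ e ⊔ Ideal.span {a ^ h} = P ^ min e (f * h) := by
  classical
  have ha0 : a ≠ 0 := by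
    rintro rfl
    exact ha' (zero_mem _)
  have hcount : Multiset.count P
      (UniqueFactorizationMonoid.normalizedFactors (Ideal.span {a})) = f :=
    Ideal.count_normalizedFactors_eq (by simpa using ha) (by simpa using ha')
  rw [Ideal.irreducible_pow_sup (by simp [ha0]) (Ideal.prime_of_isPrime hP0 hP).irreducible,
    ← Ideal.span_singleton_pow, UniqueFactorizationMonoid.normalizedFactors_pow,
    Multiset.count_nsmul, hcount, min_comm, mul_comm]

/-- In a finite quotient `R ⧸ I`, the annihilator of the class of `a` has `|R ⧸ (I + (a))|`
elements. -/
theorem Ideal.natCard_mk_mul_eq_zero {R : Type*} [CommRing R] (I : Ideal R) [Finite (R ⧸ I)]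
    (a : R) :
    Nat.card {x : R ⧸ I | Ideal.Quotient.mk I a * x = 0} =
      Nat.card (R ⧸ I ⊔ Ideal.span {a}) := by
  have hrange : LinearMap.range (LinearMap.mulLeft (R ⧸ I) (Ideal.Quotient.mk I a)) =
      (Ideal.span {a}).map (Ideal.Quotient.mk I) := by
    ext x
    simp [Ideal.map_span, Ideal.mem_span_singleton', mul_comm]
  rw [← Nat.card_congr (DoubleQuot.quotQuotEquivQuotSup I (Ideal.span {a})).toEquiv, ← hrange]
  exact LinearMap.natCard_ker_eq_natCard_quotient_range
    (LinearMap.mulLeft (R ⧸ I) (Ideal.Quotient.mk I a))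

/-- If `α ∈ B^f`, `α ∉ B^(f+1)`, then for every `h ≥ 0` the number of elements `x` of `R/Bᵉ`
with `αʰ·x = 0` is exactly `N(B)^(min e (f·h))`. -/
theorem stmt13 (K : Type*) [Field K] [NumberField K]
    (hK : Module.finrank ℚ K = 2)
    (B : Ideal (RingOfIntegers K)) (hBprime : B.IsPrime) (hB0 : B ≠ ⊥)
    (e : ℕ) (he : 0 < e)
    (f : ℕ) (hf : 0 < f)
    (α : RingOfIntegers K) (hαf : α ∈ B ^ f) (hαf1 : α ∉ B ^ (f + 1))
    (h : ℕ) :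
    Nat.card {x : RingOfIntegers K ⧸ B ^ e | (Ideal.Quotient.mk (B ^ e) α) ^ h * x = 0} =
      Ideal.absNorm B ^ min e (f * h) := by
  have hfin : Finite (RingOfIntegers K ⧸ B ^ e) :=
    Ideal.finiteQuotientOfFreeOfNeBot _ (pow_ne_zero e hB0)
  rw [← map_pow, Ideal.natCard_mk_mul_eq_zero,
    Ideal.pow_sup_span_singleton_pow hBprime hB0 hαf hαf1, ← map_pow, Ideal.absNorm_apply,
    Submodule.cardQuot_apply]
end

section
/- For every positive integer h, the number of elements x ∈ R/Bᵉ such that αʰ·x = 0 but α^{h−1}·x ≠ 0 is exactly N^{min(e, f·h)} − N^{min(e, f·(h−1))}. (This is the quantity v_h counting the vertices at level h of the trees in the functional graph.) -/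
set_option synthInstance.maxHeartbeats 1000000
set_option maxHeartbeats 1000000

open NumberField

namespace Ideal

/-- In a Dedekind domain, if `B` is a prime of exact exponent `f` in `(α)`, then multiplying by
`α ^ k` shifts membership in powers of `B` by `f * k`. -/
theorem pow_mul_mem_pow_iff {S : Type*} [CommRing S] [IsDedekindDomain S] {B : Ideal S}
    (hB : B.IsPrime) (hB0 : B ≠ ⊥) {f : ℕ} {α : S} (hα : α ∈ B ^ f) (hα' : α ∉ B ^ (f + 1))
    (k e : ℕ) (y : S) : α ^ k * y ∈ B ^ e ↔ y ∈ B ^ (e - f * k) := by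
  have hp : Prime B := prime_of_isPrime hB0 hB
  obtain ⟨J, hJ⟩ := dvd_span_singleton.2 hα
  have hBJ : ¬ B ∣ J := fun h ↦ hα' <| dvd_span_singleton.1 <| by
    rw [hJ, pow_succ]
    exact mul_dvd_mul_left _ h
  have hspan : span {α ^ k * y} = B ^ (f * k) * (J ^ k * span {y}) := by
    rw [← span_singleton_mul_span_singleton, ← span_singleton_pow, hJ, mul_pow, ← pow_mul,
      mul_assoc]
  rw [← dvd_span_singleton, ← dvd_span_singleton, hspan]
  rcases le_total e (f * k) with hle | hle
  · simp [Nat.sub_eq_zero_of_le hle, (pow_dvd_pow B hle).mul_right, ← one_eq_top]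
  · nth_rewrite 1 [← Nat.add_sub_cancel' hle]
    rw [pow_add, mul_dvd_mul_iff_left (pow_ne_zero _ hp.ne_zero)]
    exact ⟨hp.pow_dvd_of_dvd_mul_left _ fun h ↦ hBJ (hp.dvd_of_dvd_pow h),
      fun h ↦ h.mul_left _⟩

/-- For `m ≤ e`, the image of `B ^ m` in `S ⧸ B ^ e` has `N(B) ^ (e - m)` elements. -/
theorem card_map_mk_pow {S : Type*} [CommRing S] [IsDedekindDomain S] [Module.Free ℤ S]
    [Module.Finite ℤ S] {B : Ideal S} (hB : absNorm B ≠ 0) {m e : ℕ} (hm : m ≤ e) :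
    Nat.card ((B ^ m).map (Quotient.mk (B ^ e))) = absNorm B ^ (e - m) := by
  have hle : B ^ e ≤ B ^ m := pow_le_pow_right hm
  have hcard := Submodule.card_eq_card_quotient_mul_card ((B ^ m).map (Quotient.mk (B ^ e)))
  have hq : ∀ n, Nat.card (S ⧸ B ^ n) = absNorm B ^ n := fun n ↦ by
    rw [← map_pow, absNorm_apply, Submodule.cardQuot_apply]
  rw [Nat.card_congr (DoubleQuot.quotQuotEquivQuotOfLE hle).toEquiv, hq, hq] at hcard
  refine Nat.eq_of_mul_eq_mul_left (pow_pos (Nat.pos_of_ne_zero hB) m) ?_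
  rw [← pow_add, Nat.add_sub_cancel' hm, hcard, mul_comm]

/-- The annihilator of `α ^ k` in `S ⧸ B ^ e` has `N(B) ^ min e (f * k)` elements, where `f` is the
exact exponent of the prime `B` in `(α)`. -/
theorem ncard_setOf_mk_pow_mul_eq_zero {S : Type*} [CommRing S] [IsDedekindDomain S]
    [Module.Free ℤ S] [Module.Finite ℤ S] {B : Ideal S} (hB : B.IsPrime) (hB0 : B ≠ ⊥)
    (hN : absNorm B ≠ 0) {f : ℕ} {α : S} (hα : α ∈ B ^ f) (hα' : α ∉ B ^ (f + 1)) (k e : ℕ) :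
    {x : S ⧸ B ^ e | Quotient.mk (B ^ e) α ^ k * x = 0}.ncard = absNorm B ^ min e (f * k) := by
  have hset : {x : S ⧸ B ^ e | Quotient.mk (B ^ e) α ^ k * x = 0} =
      (B ^ (e - f * k)).map (Quotient.mk (B ^ e)) := by
    ext x
    obtain ⟨y, rfl⟩ := Quotient.mk_surjective x
    rw [Set.mem_ofPred_eq, ← map_pow, ← map_mul, Quotient.eq_zero_iff_mem,
      pow_mul_mem_pow_iff hB hB0 hα hα', SetLike.mem_coe,
      mem_quotient_iff_mem (pow_le_pow_right (Nat.sub_le _ _))]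
  rw [hset, ← Nat.card_coe_set_eq]
  refine (card_map_mk_pow hN (Nat.sub_le e (f * k))).trans ?_
  congr 1
  omega

end Ideal

/-- If `α ∈ B^f`, `α ∉ B^(f+1)`, then for every `h ≥ 1` the number of elements `x` of `R/Bᵉ`
with `αʰ·x = 0` but `α^(h-1)·x ≠ 0` is exactly `N(B)^(min e (f·h)) - N(B)^(min e (f·(h-1)))`. -/
theorem stmt14 (K : Type*) [Field K] [NumberField K]
    (hK : Module.finrank ℚ K = 2)
    (B : Ideal (RingOfIntegers K)) (hBprime : B.IsPrime) (hB0 : B ≠ ⊥)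
    (e : ℕ) (he : 0 < e)
    (f : ℕ) (hf : 0 < f)
    (α : RingOfIntegers K) (hαf : α ∈ B ^ f) (hαf1 : α ∉ B ^ (f + 1))
    (h : ℕ) (hh : 0 < h) :
    Nat.card {x : RingOfIntegers K ⧸ B ^ e |
        (Ideal.Quotient.mk (B ^ e) α) ^ h * x = 0 ∧
        (Ideal.Quotient.mk (B ^ e) α) ^ (h - 1) * x ≠ 0} =
      Ideal.absNorm B ^ min e (f * h) - Ideal.absNorm B ^ min e (f * (h - 1)) := by
  have hN : Ideal.absNorm B ≠ 0 := mt Ideal.absNorm_eq_zero_iff.1 hB0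
  have : Finite (RingOfIntegers K ⧸ B ^ e) :=
    (Ideal.absNorm_ne_zero_iff _).1 (by rw [map_pow]; exact pow_ne_zero _ hN)
  obtain ⟨k, rfl⟩ := Nat.exists_eq_add_of_lt hh
  simp only [zero_add, Nat.add_sub_cancel]
  rw [← Ideal.ncard_setOf_mk_pow_mul_eq_zero hBprime hB0 hN hαf hαf1 (k + 1) e,
    ← Ideal.ncard_setOf_mk_pow_mul_eq_zero hBprime hB0 hN hαf hαf1 k e, ← Set.ncard_sdiff,
    Nat.card_coe_set_eq]
  · rfl
  · intro x hx
    rw [Set.mem_ofPred_eq] at hx ⊢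
    rw [pow_succ', mul_assoc, hx, mul_zero]
end

section
/- For all integers h₁, h₂ with 1 ≤ h₁ ≤ e₁ and 1 ≤ h₂ ≤ e₂, the number of elements of the quotient ring R/(B₁^{e₁} ∩ B₂^{e₂}) whose additive order equals p₁^{h₁}·p₂^{h₂} is exactly (N₁^{h₁} − N₁^{h₁−1})·(N₂^{h₂} − N₂^{h₂−1}). -/
set_option synthInstance.maxHeartbeats 1000000
set_option maxHeartbeats 1000000

open NumberField

theorem Ideal.pow_mul_mem_pow_iff_s15 {R : Type*} [CommRing R] [IsDedekindDomain R] {P : Ideal R}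
    (hP : P.IsPrime) (hP0 : P ≠ ⊥) {a : R} (ha : a ∈ P) (ha2 : a ∉ P ^ 2) {k e : ℕ} (hk : k ≤ e)
    (r : R) : a ^ k * r ∈ P ^ e ↔ r ∈ P ^ (e - k) := by
  have hPp : Prime P := Ideal.prime_of_isPrime hP0 hP
  obtain ⟨Q, hQ⟩ : P ∣ Ideal.span {a} := by rwa [Ideal.dvd_span_singleton]
  have hPQ : ¬ P ∣ Q := fun h => ha2 <| by
    rw [← Ideal.dvd_span_singleton, hQ, pow_two]
    exact mul_dvd_mul_left P h
  have hPQk : ¬ P ∣ Q ^ k := fun h => hPQ (hPp.dvd_of_dvd_pow h)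
  rw [← Ideal.dvd_span_singleton, ← Ideal.dvd_span_singleton,
    ← Ideal.span_singleton_mul_span_singleton, ← Ideal.span_singleton_pow, hQ, mul_pow, mul_assoc]
  nth_rw 1 [← Nat.add_sub_cancel' hk]
  rw [pow_add, mul_dvd_mul_iff_left (pow_ne_zero k hPp.ne_zero)]
  exact ⟨fun h => hPp.pow_dvd_of_dvd_mul_left _ hPQk h, fun h => h.mul_left _⟩

section

variable {R : Type*} [CommRing R] [IsDedekindDomain R] [Module.Free ℤ R] [Module.Finite ℤ R]
  {P : Ideal R} {p : ℕ}

/-- The `p ^ k`-torsion of `R ⧸ P ^ e` has `N(P) ^ k` elements when `P` is unramified over `p`. -/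
theorem Ideal.card_nsmul_eq_zero_quotient_pow (hP : P.IsPrime) (hP0 : P ≠ ⊥)
    (hpP : (p : R) ∈ P) (hpP2 : (p : R) ∉ P ^ 2) {k e : ℕ} (hk : k ≤ e) :
    Nat.card {x : R ⧸ P ^ e | p ^ k • x = 0} = Ideal.absNorm P ^ k := by
  have hcard (n : ℕ) : Nat.card (R ⧸ P ^ n) = Ideal.absNorm P ^ n := by
    rw [← map_pow, Ideal.absNorm_apply]; rfl
  have hN : Ideal.absNorm P ≠ 0 := by rwa [Ne, Ideal.absNorm_eq_zero_iff]
  let f : (R ⧸ P ^ e) →+ (R ⧸ P ^ e) := nsmulAddMonoidHom (p ^ k)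
  let g : R →+ (R ⧸ P ^ e) := f.comp (Ideal.Quotient.mk (P ^ e)).toAddMonoidHom
  have hg : g.ker = (P ^ (e - k)).toAddSubgroup := by
    ext r
    rw [AddMonoidHom.mem_ker, Submodule.mem_toAddSubgroup,
      ← Ideal.pow_mul_mem_pow_iff_s15 hP hP0 hpP hpP2 hk, ← Ideal.Quotient.eq_zero_iff_mem]
    simp [f, g]
  have hfg : f.range = g.range := by
    rw [AddMonoidHom.range_comp, AddMonoidHom.range_eq_map]
    congr 1
    exact (AddMonoidHom.range_eq_top.2 Ideal.Quotient.mk_surjective).symm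
  have hrange : Nat.card f.range = Ideal.absNorm P ^ (e - k) := by
    rw [hfg, ← hcard, ← AddSubgroup.index_ker, hg]; rfl
  have hmul : Nat.card f.ker * Ideal.absNorm P ^ (e - k) = Ideal.absNorm P ^ e := by
    rw [← hrange, ← AddSubgroup.index_ker, AddSubgroup.card_mul_index, hcard]
  refine Nat.eq_of_mul_eq_mul_right (pow_pos (Nat.pos_of_ne_zero hN) (e - k)) ?_
  rw [← pow_add, Nat.add_sub_cancel' hk]
  exact hmul

/-- The number of elements of additive order `p ^ (k + 1)` in `R ⧸ P ^ e`, when `P` is unramified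
over `p`. -/
theorem Ideal.card_addOrderOf_quotient_pow (hP : P.IsPrime) (hP0 : P ≠ ⊥) (hp : p.Prime)
    (hpP : (p : R) ∈ P) (hpP2 : (p : R) ∉ P ^ 2) {k e : ℕ} (hk : k + 1 ≤ e) :
    Nat.card {x : R ⧸ P ^ e | addOrderOf x = p ^ (k + 1)} =
      Ideal.absNorm P ^ (k + 1) - Ideal.absNorm P ^ k := by
  have : Finite (R ⧸ P ^ e) := Ideal.finiteQuotientOfFreeOfNeBot _ (pow_ne_zero e hP0)
  have : Fact p.Prime := ⟨hp⟩
  have hset : {x : R ⧸ P ^ e | addOrderOf x = p ^ (k + 1)} =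
      {x | p ^ (k + 1) • x = 0} \ {x | p ^ k • x = 0} := by
    ext x
    rw [Set.mem_sdiff, Set.mem_ofPred_eq, Set.mem_ofPred_eq, Set.mem_ofPred_eq]
    refine ⟨fun h => ⟨h ▸ addOrderOf_nsmul_eq_zero x, fun h0 => ?_⟩,
      fun h => addOrderOf_eq_prime_pow h.2 h.1⟩
    have hdvd := addOrderOf_dvd_of_nsmul_eq_zero h0
    rw [h, Nat.pow_dvd_pow_iff_le_right hp.one_lt] at hdvd
    omega
  have hsub : {x : R ⧸ P ^ e | p ^ k • x = 0} ⊆ {x | p ^ (k + 1) • x = 0} := by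
    intro x (hx : p ^ k • x = 0)
    rw [Set.mem_ofPred_eq, pow_succ, mul_nsmul, hx, nsmul_zero]
  rw [hset, Nat.card_coe_set_eq, Set.ncard_sdiff hsub, ← Nat.card_coe_set_eq,
    ← Nat.card_coe_set_eq, Ideal.card_nsmul_eq_zero_quotient_pow hP hP0 hpP hpP2 hk,
    Ideal.card_nsmul_eq_zero_quotient_pow hP hP0 hpP hpP2 (Nat.le_of_succ_le hk)]

end

theorem Ideal.addOrderOf_dvd_pow_of_mem {R : Type*} [CommRing R] {P : Ideal R} {p : ℕ}
    (hpP : (p : R) ∈ P) (e : ℕ) (x : R ⧸ P ^ e) : addOrderOf x ∣ p ^ e := by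
  refine addOrderOf_dvd_of_nsmul_eq_zero ?_
  have h : ((p ^ e : ℕ) : R ⧸ P ^ e) = 0 := by
    rw [← map_natCast (Ideal.Quotient.mk (P ^ e)), Ideal.Quotient.eq_zero_iff_mem, Nat.cast_pow]
    exact Ideal.pow_mem_pow hpP e
  rw [nsmul_eq_mul, h, zero_mul]

/-- In a product of coprime factorizations, the factors are determined by the product. -/
theorem Nat.mul_eq_mul_iff_of_coprime {m n a b c d : ℕ} (hmn : m.Coprime n)
    (ha : a ∣ m) (hc : c ∣ m) (hb : b ∣ n) (hd : d ∣ n) :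
    a * b = c * d ↔ a = c ∧ b = d := by
  refine ⟨fun h => ⟨?_, ?_⟩, fun ⟨h, h'⟩ => h ▸ h' ▸ rfl⟩
  · exact Nat.dvd_antisymm
      (((hmn.coprime_dvd_left ha).coprime_dvd_right hd).dvd_of_dvd_mul_right (h ▸ dvd_mul_right a b))
      (((hmn.coprime_dvd_left hc).coprime_dvd_right hb).dvd_of_dvd_mul_right (h ▸ dvd_mul_right c d))
  · exact Nat.dvd_antisymm
      (((hmn.coprime_dvd_left hc).coprime_dvd_right hb).symm.dvd_of_dvd_mul_left
        (h ▸ dvd_mul_left b a))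
      (((hmn.coprime_dvd_left ha).coprime_dvd_right hd).symm.dvd_of_dvd_mul_left
        (h ▸ dvd_mul_left d c))

/-- Let `B₁`, `B₂` be distinct primes of the ring of integers of a quadratic number field,
lying over distinct rational primes `p₁`, `p₂` and unramified over them. For `1 ≤ hᵢ ≤ eᵢ`, the
number of elements of `R/(B₁^e₁ ∩ B₂^e₂)` of additive order `p₁^h₁·p₂^h₂` is exactly
`(N₁^h₁ - N₁^(h₁-1))·(N₂^h₂ - N₂^(h₂-1))`. -/
theorem stmt15 (K : Type*) [Field K] [NumberField K]
    (hK : Module.finrank ℚ K = 2)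
    (B₁ B₂ : Ideal (RingOfIntegers K))
    (hB₁prime : B₁.IsPrime) (hB₁0 : B₁ ≠ ⊥)
    (hB₂prime : B₂.IsPrime) (hB₂0 : B₂ ≠ ⊥)
    (hB : B₁ ≠ B₂)
    (p₁ p₂ : ℕ) (hp₁ : p₁.Prime) (hp₂ : p₂.Prime) (hpp : p₁ ≠ p₂)
    (hp₁B : (p₁ : RingOfIntegers K) ∈ B₁) (hp₁B2 : (p₁ : RingOfIntegers K) ∉ B₁ ^ 2)
    (hp₂B : (p₂ : RingOfIntegers K) ∈ B₂) (hp₂B2 : (p₂ : RingOfIntegers K) ∉ B₂ ^ 2)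
    (e₁ e₂ : ℕ) (he₁ : 0 < e₁) (he₂ : 0 < e₂)
    (h₁ h₂ : ℕ) (hh₁1 : 1 ≤ h₁) (hh₁e : h₁ ≤ e₁) (hh₂1 : 1 ≤ h₂) (hh₂e : h₂ ≤ e₂) :
    Nat.card {x : RingOfIntegers K ⧸ (B₁ ^ e₁ ⊓ B₂ ^ e₂) | addOrderOf x = p₁ ^ h₁ * p₂ ^ h₂} =
      (Ideal.absNorm B₁ ^ h₁ - Ideal.absNorm B₁ ^ (h₁ - 1)) *
      (Ideal.absNorm B₂ ^ h₂ - Ideal.absNorm B₂ ^ (h₂ - 1)) := by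
  have hcop : IsCoprime (B₁ ^ e₁) (B₂ ^ e₂) := by
    have := hB₁prime.isMaximal hB₁0
    have := hB₂prime.isMaximal hB₂0
    exact (Ideal.isCoprime_of_isMaximal hB).pow
  have hpcop : (p₁ ^ e₁).Coprime (p₂ ^ e₂) :=
    Nat.Coprime.pow _ _ ((Nat.coprime_primes hp₁ hp₂).2 hpp)
  let φ := Ideal.quotientInfEquivQuotientProd (B₁ ^ e₁) (B₂ ^ e₂) hcop
  have hφ (x : RingOfIntegers K ⧸ (B₁ ^ e₁ ⊓ B₂ ^ e₂)) :
      x ∈ {x | addOrderOf x = p₁ ^ h₁ * p₂ ^ h₂} ↔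
        φ x ∈ {y : RingOfIntegers K ⧸ B₁ ^ e₁ | addOrderOf y = p₁ ^ h₁} ×ˢ
          {z : RingOfIntegers K ⧸ B₂ ^ e₂ | addOrderOf z = p₂ ^ h₂} := by
    have hy := Ideal.addOrderOf_dvd_pow_of_mem hp₁B e₁ (φ x).1
    have hz := Ideal.addOrderOf_dvd_pow_of_mem hp₂B e₂ (φ x).2
    have hyz := (hpcop.coprime_dvd_left hy).coprime_dvd_right hz
    rw [Set.mem_ofPred_eq, ← addOrderOf_injective φ.toAddMonoidHom φ.injective x, Set.mem_prod,
      Set.mem_ofPred_eq, Set.mem_ofPred_eq, ← Nat.mul_eq_mul_iff_of_coprime hpcop hy (pow_dvd_pow p₁ hh₁e) hz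
        (pow_dvd_pow p₂ hh₂e), ← hyz.lcm_eq_mul, ← Prod.addOrderOf]
    rfl
  obtain ⟨k₁, rfl⟩ := Nat.exists_eq_add_of_le' hh₁1
  obtain ⟨k₂, rfl⟩ := Nat.exists_eq_add_of_le' hh₂1
  rw [Nat.card_congr (φ.toEquiv.subtypeEquiv hφ), Nat.card_congr (Equiv.Set.prod _ _),
    Nat.card_prod, Ideal.card_addOrderOf_quotient_pow hB₁prime hB₁0 hp₁ hp₁B hp₁B2 hh₁e,
    Ideal.card_addOrderOf_quotient_pow hB₂prime hB₂0 hp₂ hp₂B hp₂B2 hh₂e]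
  rfl
end
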